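/- arXiv:1812.01307 — 2 statements merged into one kernel-verified Lean document; each statement's English description precedes it below -/
import Mathlib

section
/- Let A be a real r×c matrix with full column rank (rank A = c), let y ∈ ℝ^r, and let u_max denote the largest eigenvalue of the symmetric positive definite matrix AᵀA. If the constant step size μ satisfies 0 < μ < 1/(2·u_max), then any sequence (x^k) in ℝ^c satisfying the stale-gradient iteration x^{k+1} = x^k + 2μ·Aᵀ(y − A·x^{k−1}) for all k ≥ 1 converges to the least-squares solution x* = (AᵀA)⁻¹·Aᵀ·y. -/
open Filter Matrix

/-- Solutions of the delayed scalar recursion `z (n + 2) = z (n + 1) - a * z n` with `0 < a < 1`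
tend to zero. -/
theorem tendsto_zero_of_delayed_recurrence {a : ℝ} (ha0 : 0 < a) (ha1 : a < 1) {z : ℕ → ℝ}
    (hz : ∀ n, z (n + 2) = z (n + 1) - a * z n) : Tendsto z atTop (nhds 0) := by
  -- A quadratic Lyapunov function for the recursion.
  let V : ℕ → ℝ := fun n ↦ (1 + a) * z (n + 1) ^ 2 - 2 * a * z (n + 1) * z n +
    (2 * a + a ^ 2 + a ^ 3) / 2 * z n ^ 2
  have hε : 0 < a * (1 - a) * (2 + a) / 2 := by
    have : 0 < 1 - a := by linarith
    positivity
  have hstep : ∀ n, V n - V (n + 1) =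
      a * (1 - a) * (2 + a) / 2 * (z (n + 1) ^ 2 + z n ^ 2) := by
    intro n
    simp only [V, hz]
    ring
  have hV : ∀ n, 0 ≤ V n := by
    intro n
    have hsq : V n = z (n + 1) ^ 2 + a * (z (n + 1) - z n) ^ 2 +
        (a ^ 2 + a ^ 3) / 2 * z n ^ 2 := by
      simp only [V]
      ring
    rw [hsq]
    positivity
  have hsum : ∀ n, ∑ i ∈ Finset.range n, z i ^ 2 ≤ V 0 / (a * (1 - a) * (2 + a) / 2) := by
    intro n
    rw [le_div_iff₀ hε, Finset.sum_mul]
    calc ∑ i ∈ Finset.range n, z i ^ 2 * (a * (1 - a) * (2 + a) / 2)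
        ≤ ∑ i ∈ Finset.range n, (V i - V (i + 1)) := by
          refine Finset.sum_le_sum fun i _ ↦ ?_
          rw [hstep, mul_comm]
          gcongr
          linarith [sq_nonneg (z (i + 1))]
      _ = V 0 - V n := Finset.sum_range_sub' V n
      _ ≤ V 0 := by linarith [hV n]
  have hsq : Tendsto (fun n ↦ z n ^ 2) atTop (nhds 0) :=
    (summable_of_sum_range_le (fun n ↦ sq_nonneg (z n)) hsum).tendsto_atTop_zero
  exact (tendsto_zero_iff_abs_tendsto_zero z).2
    (by simpa [Real.sqrt_sq_eq_abs, Function.comp_def] using hsq.sqrt)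

/-- If `s` times every eigenvalue of the symmetric matrix `H` lies in `(0, 1)`, then solutions of
`e (n + 2) = e (n + 1) - s • H *ᵥ e n` tend to zero. -/
theorem Matrix.IsHermitian.tendsto_zero_of_delayed_recurrence {n : Type*} [Fintype n]
    [DecidableEq n] {H : Matrix n n ℝ} (hH : H.IsHermitian) {s : ℝ}
    (hpos : ∀ i, 0 < s * hH.eigenvalues i) (hlt : ∀ i, s * hH.eigenvalues i < 1)
    {e : ℕ → n → ℝ} (he : ∀ k, e (k + 2) = e (k + 1) - s • (H *ᵥ e k)) :
    Tendsto e atTop (nhds 0) := by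
  set U := (hH.eigenvectorUnitary : Matrix n n ℝ)
  have hUU : star U * U = 1 := Unitary.coe_star_mul_self _
  have hUU' : U * star U = 1 := Unitary.coe_mul_star_self _
  have hdiag : star U * H = diagonal hH.eigenvalues * star U := by
    have h := hH.conjStarAlgAut_star_eigenvectorUnitary
    rw [Unitary.conjStarAlgAut_star_apply] at h
    have h' : star U * H * U = diagonal hH.eigenvalues := h
    rw [← h', Matrix.mul_assoc (star U * H), hUU', Matrix.mul_one]
  have hcoord : Tendsto (fun k ↦ star U *ᵥ e k) atTop (nhds 0) := by
    refine tendsto_pi_nhds.2 fun i ↦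
      _root_.tendsto_zero_of_delayed_recurrence (hpos i) (hlt i) fun k ↦ ?_
    rw [he, mulVec_sub, mulVec_smul, mulVec_mulVec, hdiag, ← mulVec_mulVec]
    simp only [Pi.sub_apply, Pi.smul_apply, mulVec_diagonal, smul_eq_mul, mul_assoc]
  have hcont : Continuous fun v : n → ℝ ↦ U *ᵥ v := continuous_const.matrix_mulVec continuous_id
  have h := (hcont.tendsto 0).comp hcoord
  simpa [Function.comp_def, mulVec_mulVec, hUU'] using h

/-- The eigenvalues of `Aᵀ * A` are positive when `A` has full column rank. -/
theorem Matrix.eigenvalues_transpose_mul_self_pos {m n : Type*} [Fintype m] [Fintype n]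
    [DecidableEq n] {A : Matrix m n ℝ} (hrank : A.rank = Fintype.card n)
    (hA : (Aᵀ * A).IsHermitian) (i : n) : 0 < hA.eigenvalues i := by
  have hnonneg : 0 ≤ hA.eigenvalues i := (posSemidef_conjTranspose_mul_self A).eigenvalues_nonneg i
  refine hnonneg.lt_of_ne' fun hi ↦ ?_
  have hcard := hA.rank_eq_card_non_zero_eigs
  rw [rank_transpose_mul_self, hrank] at hcard
  exact (Fintype.card_subtype_lt (p := fun j ↦ hA.eigenvalues j ≠ 0) (not_not.2 hi)).ne' hcard

/-- If `A` has full column rank, `u_max` is the largest eigenvalue of `AᵀA`,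
and `0 < μ < 1/(2 u_max)`, then any sequence satisfying the stale-gradient iteration
`x^{k+1} = x^k + 2μ Aᵀ(y − A x^{k−1})` (k ≥ 1) converges to the least-squares solution
`(AᵀA)⁻¹ Aᵀ y`. -/
theorem bsgd_stale_gradient_converges
    {r c : ℕ} (A : Matrix (Fin r) (Fin c) ℝ) (y : Fin r → ℝ)
    (hrank : A.rank = c)
    (hHerm : (Aᵀ * A).IsHermitian)
    (umax : ℝ)
    (humax_le : ∀ i : Fin c, hHerm.eigenvalues i ≤ umax)
    (humax_mem : ∃ i : Fin c, hHerm.eigenvalues i = umax)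
    (μ : ℝ) (hμ0 : 0 < μ) (hμ1 : μ < 1 / (2 * umax))
    (x : ℕ → Fin c → ℝ)
    (hiter : ∀ k : ℕ, 1 ≤ k →
      x (k + 1) = x k + (2 * μ) • (Aᵀ *ᵥ (y - A *ᵥ x (k - 1)))) :
    Tendsto x atTop (nhds ((Aᵀ * A)⁻¹ *ᵥ (Aᵀ *ᵥ y))) := by
  have hpos := eigenvalues_transpose_mul_self_pos (by simpa using hrank) hHerm
  have hu : 0 < umax := by
    obtain ⟨i, rfl⟩ := humax_mem
    exact hpos i
  have hμu : 2 * μ * umax < 1 := by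
    rw [lt_div_iff₀ (by positivity)] at hμ1
    linarith
  have hdet : IsUnit (Aᵀ * A).det := by
    rw [isUnit_iff_ne_zero]
    exact (hHerm.posDef_iff_eigenvalues_pos.2 hpos).det_pos.ne'
  set xs := (Aᵀ * A)⁻¹ *ᵥ (Aᵀ *ᵥ y) with hxs
  have hnormal : (Aᵀ * A) *ᵥ xs = Aᵀ *ᵥ y := by
    rw [hxs, mulVec_mulVec, mul_nonsing_inv _ hdet, one_mulVec]
  have herr : Tendsto (fun k ↦ x k - xs) atTop (nhds 0) := by
    refine hHerm.tendsto_zero_of_delayed_recurrence (s := 2 * μ)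
      (fun i ↦ mul_pos (by positivity) (hpos i))
      (fun i ↦ (mul_le_mul_of_nonneg_left (humax_le i) (by positivity)).trans_lt hμu)
      fun k ↦ ?_
    rw [hiter (k + 1) (Nat.le_add_left 1 k), Nat.add_sub_cancel, mulVec_sub, mulVec_sub, hnormal,
      mulVec_mulVec]
    module
  exact tendsto_sub_nhds_zero_iff.1 herr
end

section
/- Let A be a real r×c matrix and μ > 0 a real number. A complex number v is an eigenvalue of the 2c×2c block matrix M = [[0, I], [−2μ·AᵀA, I]] (regarded as a complex matrix) if and only if there exists an eigenvalue u of AᵀA (a real number, since AᵀA is symmetric) such that v² − v + 2μ·u = 0. -/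
open Matrix

/-- A companion-type block matrix has determinant zero exactly when its Schur complement does. -/
lemma Matrix.det_fromBlocks_scalar_one_eq_zero_iff {n K : Type*} [Fintype n] [DecidableEq n]
    [Field K] (C D : Matrix n n K) (v : K) :
    (fromBlocks (-(v • (1 : Matrix n n K))) 1 C D).det = 0 ↔ (C + v • D).det = 0 := by
  have hP : (fromBlocks (0 : Matrix n n K) 1 1 (v • (1 : Matrix n n K))).det ≠ 0 := by
    refine left_ne_zero_of_mul_eq_one
      (b := (fromBlocks (-(v • (1 : Matrix n n K))) 1 1 (0 : Matrix n n K)).det) ?_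
    rw [← det_mul, fromBlocks_multiply]
    simp
  have h : (fromBlocks (-(v • (1 : Matrix n n K))) 1 C D).det *
      (fromBlocks (0 : Matrix n n K) 1 1 (v • (1 : Matrix n n K))).det = (C + v • D).det := by
    rw [← det_mul, fromBlocks_multiply]
    simp
  rw [← h, mul_eq_zero, or_iff_left hP]

/-- The complex eigenvalues of a real symmetric matrix are its real eigenvalues. -/
lemma Matrix.IsHermitian.det_smul_one_sub_map_ofReal_eq_zero_iff {n : Type*} [Fintype n]
    [DecidableEq n] {S : Matrix n n ℝ} (hS : S.IsHermitian) (w : ℂ) :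
    (w • (1 : Matrix n n ℂ) - S.map (fun a => (a : ℂ))).det = 0 ↔
      ∃ u : ℝ, (S - u • (1 : Matrix n n ℝ)).det = 0 ∧ w = u := by
  have hc : (w • (1 : Matrix n n ℂ) - S.map (fun a => (a : ℂ))).det =
      ∏ i, (w - hS.eigenvalues i) := by
    have h := eval_charpoly (S.map Complex.ofRealHom) w
    rw [charpoly_map, hS.charpoly_eq, scalar_apply, ← smul_one_eq_diagonal] at h
    exact h.symm.trans (by simp [Polynomial.map_prod, Polynomial.eval_prod])
  have hr (u : ℝ) : (S - u • (1 : Matrix n n ℝ)).det = 0 ↔ ∃ i, u = hS.eigenvalues i := by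
    have h := eval_charpoly S u
    rw [hS.charpoly_eq, scalar_apply, ← smul_one_eq_diagonal] at h
    rw [← neg_sub, det_neg, ← h]
    simp [Polynomial.eval_prod, Finset.prod_eq_zero_iff, sub_eq_zero]
  simp only [hc, hr, Finset.prod_eq_zero_iff, Finset.mem_univ, true_and, sub_eq_zero]
  constructor
  · rintro ⟨i, hi⟩
    exact ⟨_, ⟨i, rfl⟩, hi⟩
  · rintro ⟨_, ⟨i, rfl⟩, hi⟩
    exact ⟨i, hi⟩

/-- for `μ > 0`, a complex number `v` is an eigenvalue of the block matrix
`M = [[0, I], [−2μ·AᵀA, I]]` iff there is a (real) eigenvalue `u` of `AᵀA` with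
`v² − v + 2μu = 0`. -/
theorem block_matrix_eigenvalue_iff
    {r c : ℕ} (A : Matrix (Fin r) (Fin c) ℝ) (μ : ℝ) (hμ : 0 < μ) (v : ℂ) :
    ((Matrix.fromBlocks
        (0 : Matrix (Fin c) (Fin c) ℂ) (1 : Matrix (Fin c) (Fin c) ℂ)
        (-((2 * μ : ℝ) : ℂ) • ((Aᵀ * A).map (fun a => (a : ℂ))))
        (1 : Matrix (Fin c) (Fin c) ℂ)
      - v • (1 : Matrix (Fin c ⊕ Fin c) (Fin c ⊕ Fin c) ℂ)).det = 0)
    ↔ ∃ u : ℝ, ((Aᵀ * A) - u • (1 : Matrix (Fin c) (Fin c) ℝ)).det = 0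
        ∧ v ^ 2 - v + 2 * (μ : ℂ) * (u : ℂ) = 0 := by
  have hμ' : (μ : ℂ) ≠ 0 := by exact_mod_cast hμ.ne'
  have hM : Matrix.fromBlocks
        (0 : Matrix (Fin c) (Fin c) ℂ) (1 : Matrix (Fin c) (Fin c) ℂ)
        (-((2 * μ : ℝ) : ℂ) • ((Aᵀ * A).map (fun a => (a : ℂ))))
        (1 : Matrix (Fin c) (Fin c) ℂ)
      - v • (1 : Matrix (Fin c ⊕ Fin c) (Fin c ⊕ Fin c) ℂ) =
      fromBlocks (-(v • (1 : Matrix (Fin c) (Fin c) ℂ))) 1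
        (-((2 * μ : ℝ) : ℂ) • ((Aᵀ * A).map (fun a => (a : ℂ)))) (1 - v • 1) := by
    rw [← fromBlocks_one, fromBlocks_smul, sub_eq_add_neg, fromBlocks_neg, fromBlocks_add]
    simp [sub_eq_add_neg]
  have hX : -((2 * μ : ℝ) : ℂ) • ((Aᵀ * A).map (fun a => (a : ℂ))) +
      v • (1 - v • (1 : Matrix (Fin c) (Fin c) ℂ)) =
      (2 * μ : ℂ) • (((v - v ^ 2) / (2 * μ)) • (1 : Matrix (Fin c) (Fin c) ℂ) -
        (Aᵀ * A).map (fun a => (a : ℂ))) := by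
    rw [smul_sub (2 * μ : ℂ), smul_smul, mul_div_cancel₀ _ (by simpa using hμ')]
    push_cast
    module
  have hS : (Aᵀ * A).IsHermitian := by
    simpa using isHermitian_conjTranspose_mul_self A
  rw [hM, det_fromBlocks_scalar_one_eq_zero_iff, hX, det_smul, mul_eq_zero,
    or_iff_right (pow_ne_zero _ (by simpa using hμ')),
    hS.det_smul_one_sub_map_ofReal_eq_zero_iff]
  refine exists_congr fun u => and_congr_right fun _ => ?_
  rw [div_eq_iff (by simpa using hμ')]
  constructor <;> intro h <;> linear_combination -h
end
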